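/- Let 𝕋 be a time scale and α ∈ (0,1]. Let g : 𝕋 → ℝ be strictly increasing and suppose 𝕋̃ := g(𝕋) is a time scale (i.e., a nonempty closed subset of ℝ). Suppose g is nabla fractional differentiable of order α at t ∈ 𝕋^k, and f : 𝕋̃ → ℝ is nabla fractional differentiable of order 1 at every point of 𝕋̃^k with ∇^(1)f continuous on 𝕋̃^k. Then f ∘ g is nabla fractional differentiable of order α at t with ∇^(α)(f ∘ g)(t) = (∇^(1)f)(g(t)) · ∇^(α)g(t), where ∇^(1)f is the nabla fractional derivative of order 1 computed in the time scale 𝕋̃. -/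

import Mathlib

open Set Filter
open scoped Classical

/-- Backward jump operator on a time scale `T`. -/
noncomputable def rho (T : Set ℝ) (t : ℝ) : ℝ :=
  if ({s ∈ T | s < t}).Nonempty then sSup {s ∈ T | s < t} else t

/-- Forward jump operator on a time scale `T`. -/
noncomputable def sigmaTS (T : Set ℝ) (t : ℝ) : ℝ :=
  if ({s ∈ T | t < s}).Nonempty then sInf {s ∈ T | t < s} else t

/-- Graininess `ν(t) = t - ρ(t)`. -/
noncomputable def nu (T : Set ℝ) (t : ℝ) : ℝ := t - rho T t

/-- `𝕋^k`: remove the minimum of `T` when it exists and is right-scattered. -/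
def Tk (T : Set ℝ) : Set ℝ :=
  {t ∈ T | ¬ (IsLeast T t ∧ t < sigmaTS T t)}

/-- The set `Q = {1/q : q an odd positive integer}`. -/
def QOdd : Set ℝ := {x : ℝ | ∃ q : ℕ, Odd q ∧ 0 < q ∧ x = 1 / (q : ℝ)}

/-- Real odd root power: `sign(x) * |x| ^ α`. -/
noncomputable def oddPow (α x : ℝ) : ℝ := Real.sign x * |x| ^ α

/-- The power `x ^ α` used in nabla fractional differentiation: the real odd
root when `α ∈ QOdd`, the usual real power otherwise. -/
noncomputable def fpow (α x : ℝ) : ℝ := if α ∈ QOdd then oddPow α x else x ^ α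

/-- The neighborhood of `t` used in the definition of the nabla fractional
derivative: `U_δ(t)` when `α ∈ QOdd`, `U_δ⁻(t)` otherwise. -/
noncomputable def Unbhd (T : Set ℝ) (α t δ : ℝ) : Set ℝ :=
  if α ∈ QOdd then Ioo (t - δ) (t + δ) ∩ T else Ioo (t - δ) t ∩ T

/-- `f` is nabla fractional differentiable of order `α` at `t ∈ T^k` with
derivative `L`. -/
def nablaDiffAt (T : Set ℝ) (α : ℝ) (f : ℝ → ℝ) (t L : ℝ) : Prop :=
  ∀ ε > 0, ∃ δ > 0, ∀ s ∈ Unbhd T α t δ,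
    |(f (rho T t) - f s) - L * fpow α (rho T t - s)| ≤ ε * |rho T t - s| ^ α

/-- `f` is continuous at `t` in the time-scale sense. -/
def contAt (T : Set ℝ) (f : ℝ → ℝ) (t : ℝ) : Prop :=
  ∀ ε > 0, ∃ δ > 0, ∀ s ∈ Ioo (t - δ) (t + δ) ∩ T, |f t - f s| < ε

/-- `f` is left-continuous at `t` in the time-scale sense. -/
def leftContAt (T : Set ℝ) (f : ℝ → ℝ) (t : ℝ) : Prop :=
  ∀ ε > 0, ∃ δ > 0, ∀ s ∈ Ioo (t - δ) t ∩ T, |f t - f s| < ε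

/-- `f` has a local left-maximum at `t₀`. -/
def localLeftMax (T : Set ℝ) (f : ℝ → ℝ) (t₀ : ℝ) : Prop :=
  (rho T t₀ < t₀ → f (rho T t₀) ≤ f t₀) ∧
  (rho T t₀ = t₀ → ∃ δ > 0, ∀ s ∈ Ioo (t₀ - δ) t₀ ∩ T, f s ≤ f t₀)

/-- `f` has a local left-minimum at `t₀`. -/
def localLeftMin (T : Set ℝ) (f : ℝ → ℝ) (t₀ : ℝ) : Prop :=
  (rho T t₀ < t₀ → f t₀ ≤ f (rho T t₀)) ∧
  (rho T t₀ = t₀ → ∃ δ > 0, ∀ s ∈ Ioo (t₀ - δ) t₀ ∩ T, f t₀ ≤ f s)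

/-- A strictly increasing function with closed image is right-continuous on its domain. -/
lemma StrictMonoOn.exists_right_lt_of_isClosed_image {T : Set ℝ} {g : ℝ → ℝ}
    (hg : StrictMonoOn g T) (hT' : IsClosed (g '' T)) {t : ℝ} (ht : t ∈ T) {ε : ℝ} (hε : 0 < ε) :
    ∃ δ > 0, ∀ s ∈ T, s < t + δ → g s < g t + ε := by
  by_contra! h
  have hlb : ∀ s ∈ T, t < s → g t + ε ≤ g s := by
    intro s hs hts
    obtain ⟨r, hr, hrs, hgr⟩ := h (s - t) (by linarith)
    exact hgr.trans ((hg.le_iff_le hr hs).2 (by linarith))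
  obtain ⟨s₁, hs₁, -, hgs₁⟩ := h 1 one_pos
  have hts₁ : t < s₁ := (hg.lt_iff_lt ht hs₁).1 (by linarith)
  have hne : (g '' {s ∈ T | t < s}).Nonempty := ⟨g s₁, s₁, ⟨hs₁, hts₁⟩, rfl⟩
  have hbdd : BddBelow (g '' {s ∈ T | t < s}) :=
    ⟨g t + ε, by rintro _ ⟨s, ⟨hs, hts⟩, rfl⟩; exact hlb s hs hts⟩
  obtain ⟨s₀, hs₀, hgs₀⟩ : sInf (g '' {s ∈ T | t < s}) ∈ g '' T :=
    closure_minimal (image_mono fun _ h => h.1) hT' (csInf_mem_closure hne hbdd)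
  have hle : g t + ε ≤ g s₀ := by
    rw [hgs₀]
    exact le_csInf hne (by rintro _ ⟨s, ⟨hs, hts⟩, rfl⟩; exact hlb s hs hts)
  have hts₀ : t < s₀ := (hg.lt_iff_lt ht hs₀).1 (by linarith)
  obtain ⟨r, hr, hrs, hgr⟩ := h (s₀ - t) (by linarith)
  have htr : t < r := (hg.lt_iff_lt ht hr).1 (by linarith)
  have h₁ : g r < g s₀ := hg hr hs₀ (by linarith)
  have h₂ : g s₀ ≤ g r := hgs₀ ▸ csInf_le hbdd ⟨r, ⟨hr, htr⟩, rfl⟩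
  linarith

/-- A strictly increasing function with closed image is left-continuous on its domain. -/
lemma StrictMonoOn.exists_left_lt_of_isClosed_image {T : Set ℝ} {g : ℝ → ℝ}
    (hg : StrictMonoOn g T) (hT' : IsClosed (g '' T)) {t : ℝ} (ht : t ∈ T) {ε : ℝ} (hε : 0 < ε) :
    ∃ δ > 0, ∀ s ∈ T, t - δ < s → g t - ε < g s := by
  have hmono : StrictMonoOn (fun x => -g (-x)) (-T) := fun x hx y hy hxy =>
    neg_lt_neg (hg hy hx (neg_lt_neg hxy))
  have himage : (fun x => -g (-x)) '' (-T) = -(g '' T) := by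
    ext y
    constructor
    · rintro ⟨x, hx, rfl⟩
      exact ⟨-x, hx, by simp⟩
    · rintro ⟨x, hx, hxy⟩
      exact ⟨-x, by simpa using hx, by simp [hxy]⟩
  obtain ⟨δ, hδ, h⟩ := hmono.exists_right_lt_of_isClosed_image (himage ▸ hT'.neg)
    (t := -t) (by simpa using ht) hε
  refine ⟨δ, hδ, fun s hs hts => ?_⟩
  have := h (-s) (by simpa using hs) (by linarith)
  simp only [neg_neg] at this
  linarith

/-- A strictly increasing function with closed image is continuous in the time-scale sense. -/
lemma StrictMonoOn.contAt_of_isClosed_image {T : Set ℝ} {g : ℝ → ℝ}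
    (hg : StrictMonoOn g T) (hT' : IsClosed (g '' T)) {t : ℝ} (ht : t ∈ T) :
    contAt T g t := by
  intro ε hε
  obtain ⟨δ₁, hδ₁, h₁⟩ := hg.exists_right_lt_of_isClosed_image hT' ht hε
  obtain ⟨δ₂, hδ₂, h₂⟩ := hg.exists_left_lt_of_isClosed_image hT' ht hε
  refine ⟨min δ₁ δ₂, lt_min hδ₁ hδ₂, ?_⟩
  rintro s ⟨⟨hls, hrs⟩, hs⟩
  have := h₁ s hs (by linarith [min_le_left δ₁ δ₂])
  have := h₂ s hs (by linarith [min_le_right δ₁ δ₂])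
  rw [abs_lt]
  constructor <;> linarith

lemma setOf_image_lt_nonempty_iff {T : Set ℝ} {g : ℝ → ℝ} (hg : StrictMonoOn g T)
    {t : ℝ} (ht : t ∈ T) :
    {u ∈ g '' T | u < g t}.Nonempty ↔ {s ∈ T | s < t}.Nonempty := by
  constructor
  · rintro ⟨_, ⟨s, hs, rfl⟩, hst⟩
    exact ⟨s, hs, (hg.lt_iff_lt hs ht).1 hst⟩
  · rintro ⟨s, hs, hst⟩
    exact ⟨g s, ⟨s, hs, rfl⟩, hg hs ht hst⟩

/-- The backward jump operator commutes with a strictly increasing map of time scales. -/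
lemma rho_image {T : Set ℝ} (hT : IsClosed T) {g : ℝ → ℝ} (hg : StrictMonoOn g T)
    (hT' : IsClosed (g '' T)) {t : ℝ} (ht : t ∈ T) :
    rho (g '' T) (g t) = g (rho T t) := by
  by_cases hne : {s ∈ T | s < t}.Nonempty
  swap
  · rw [rho, rho, if_neg hne, if_neg (mt (setOf_image_lt_nonempty_iff hg ht).1 hne)]
  have hne' := (setOf_image_lt_nonempty_iff hg ht).2 hne
  rw [rho, rho, if_pos hne, if_pos hne']
  have hbdd : BddAbove {s ∈ T | s < t} := ⟨t, fun s hs => hs.2.le⟩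
  have hbdd' : BddAbove {u ∈ g '' T | u < g t} := ⟨g t, fun u hu => hu.2.le⟩
  have hr : sSup {s ∈ T | s < t} ∈ T :=
    closure_minimal (fun _ h => h.1) hT (csSup_mem_closure hne hbdd)
  obtain ⟨s₀, hs₀, hgs₀⟩ : sSup {u ∈ g '' T | u < g t} ∈ g '' T :=
    closure_minimal (fun _ h => h.1) hT' (csSup_mem_closure hne' hbdd')
  rw [← hgs₀]
  congr 1
  refine le_antisymm ?_ (csSup_le hne fun s hs => ?_)
  · rw [← hg.le_iff_le hs₀ hr, hgs₀]
    refine csSup_le hne' ?_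
    rintro _ ⟨⟨s, hs, rfl⟩, hst⟩
    exact (hg.le_iff_le hs hr).2 (le_csSup hbdd ⟨hs, (hg.lt_iff_lt hs ht).1 hst⟩)
  · rw [← hg.le_iff_le hs.1 hs₀, hgs₀]
    exact le_csSup hbdd' ⟨⟨s, hs.1, rfl⟩, hg hs.1 ht hs.2⟩

/-- A strictly increasing map of time scales sends `𝕋^k` into `𝕋̃^k`. -/
lemma image_mem_Tk {T : Set ℝ} {g : ℝ → ℝ} (hg : StrictMonoOn g T)
    (hT' : IsClosed (g '' T)) {t : ℝ} (ht : t ∈ Tk T) : g t ∈ Tk (g '' T) := by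
  refine ⟨⟨t, ht.1, rfl⟩, ?_⟩
  rintro ⟨hleast, hσ⟩
  refine ht.2 ⟨⟨ht.1, fun s hs => (hg.le_iff_le ht.1 hs).1 (hleast.2 ⟨s, hs, rfl⟩)⟩, ?_⟩
  have hne' : {u ∈ g '' T | g t < u}.Nonempty := by
    by_contra h
    rw [sigmaTS, if_neg h] at hσ
    exact lt_irrefl _ hσ
  have hne : {s ∈ T | t < s}.Nonempty := by
    obtain ⟨_, ⟨s, hs, rfl⟩, hst⟩ := hne'
    exact ⟨s, hs, (hg.lt_iff_lt ht.1 hs).1 hst⟩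
  rw [sigmaTS, if_pos hne'] at hσ
  rw [sigmaTS, if_pos hne]
  obtain ⟨δ, hδ, h⟩ := hg.exists_right_lt_of_isClosed_image hT' ht.1 (sub_pos.2 hσ)
  refine (lt_add_of_pos_right t hδ).trans_le (le_csInf hne fun s hs => ?_)
  by_contra! hlt
  have h₁ := h s hs.1 hlt
  have h₂ : sInf {u ∈ g '' T | g t < u} ≤ g s :=
    csInf_le ⟨g t, fun u hu => hu.2.le⟩ ⟨⟨s, hs.1, rfl⟩, hg ht.1 hs.1 hs.2⟩
  linarith

lemma abs_fpow_le (α x : ℝ) : |fpow α x| ≤ |x| ^ α := by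
  unfold fpow oddPow
  split_ifs
  · rw [abs_mul, abs_of_nonneg (Real.rpow_nonneg (abs_nonneg x) α)]
    refine mul_le_of_le_one_left (Real.rpow_nonneg (abs_nonneg x) α) ?_
    rcases Real.sign_apply_eq x with h | h | h <;> simp [h]
  · exact Real.abs_rpow_le_abs_rpow x α

lemma one_mem_QOdd : (1 : ℝ) ∈ QOdd := ⟨1, odd_one, one_pos, by simp⟩

lemma fpow_one (x : ℝ) : fpow 1 x = x := by
  rw [fpow, if_pos one_mem_QOdd, oddPow, Real.rpow_one]
  rcases lt_trichotomy x 0 with h | h | h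
  · rw [Real.sign_of_neg h, abs_of_neg h]; ring
  · simp [h]
  · rw [Real.sign_of_pos h, abs_of_pos h]; ring

lemma Unbhd_subset (T : Set ℝ) (α t : ℝ) {δ : ℝ} (hδ : 0 < δ) :
    Unbhd T α t δ ⊆ Ioo (t - δ) (t + δ) ∩ T := by
  unfold Unbhd
  split_ifs
  · exact Subset.rfl
  · exact fun s hs => ⟨⟨hs.1.1, by linarith [hs.1.2]⟩, hs.2⟩

lemma Unbhd_mono (T : Set ℝ) (α t : ℝ) {δ δ' : ℝ} (h : δ ≤ δ') :
    Unbhd T α t δ ⊆ Unbhd T α t δ' := by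
  unfold Unbhd
  split_ifs
  · exact inter_subset_inter_left _ (Ioo_subset_Ioo (by linarith) (by linarith))
  · exact inter_subset_inter_left _ (Ioo_subset_Ioo (by linarith) le_rfl)

/-- For `g : 𝕋 → ℝ` strictly increasing with `𝕋̃ = g(𝕋)` a time
scale, `g` nabla fractional differentiable of order `α` at `t ∈ 𝕋^k`, and `f`
continuously nabla differentiable of order `1` on `𝕋̃^k`,
`∇^(α)(f ∘ g)(t) = (∇^(1) f)(g(t)) · ∇^(α) g(t)`. -/
theorem stmt15 (T : Set ℝ) (hTne : T.Nonempty) (hTcl : IsClosed T)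
    (α : ℝ) (hα : α ∈ Set.Ioc (0 : ℝ) 1)
    (g : ℝ → ℝ) (hg : StrictMonoOn g T) (hT' : IsClosed (g '' T))
    (t : ℝ) (ht : t ∈ Tk T)
    (G : ℝ) (hgdiff : nablaDiffAt T α g t G)
    (f f' : ℝ → ℝ)
    (hfdiff : ∀ u ∈ Tk (g '' T), nablaDiffAt (g '' T) 1 f u (f' u))
    (hf'cont : ∀ u ∈ Tk (g '' T), contAt (g '' T) f' u) :
    nablaDiffAt T α (f ∘ g) t (f' (g t) * G) := by
  intro ε hε
  set D := f' (g t) with hD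
  set η := ε / (2 * (|D| + 1)) with hη
  have hη0 : 0 < η := by positivity
  set θ := ε / (2 * (|G| + η)) with hθ
  have hθ0 : 0 < θ := by positivity
  have hηD : |D| * η ≤ ε / 2 := by
    have : (|D| + 1) * η = ε / 2 := by rw [hη]; field_simp
    linarith
  have hθG : θ * (|G| + η) = ε / 2 := by rw [hθ]; field_simp
  obtain ⟨δ₁, hδ₁, h₁⟩ := hgdiff η hη0
  obtain ⟨κ, hκ, hf⟩ := hfdiff (g t) (image_mem_Tk hg hT' ht) θ hθ0
  obtain ⟨δ₂, hδ₂, h₂⟩ := hg.contAt_of_isClosed_image hT' ht.1 κ hκ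
  refine ⟨min δ₁ δ₂, lt_min hδ₁ hδ₂, fun s hs => ?_⟩
  have hgs := h₁ s (Unbhd_mono T α t (min_le_left _ _) hs)
  have hs₂ := Unbhd_subset T α t hδ₂ (Unbhd_mono T α t (min_le_right _ _) hs)
  have hκs := abs_lt.1 (h₂ s hs₂)
  have hfs := hf (g s) (by
    rw [Unbhd, if_pos one_mem_QOdd]
    exact ⟨⟨by linarith, by linarith⟩, s, hs₂.2, rfl⟩)
  rw [rho_image hTcl hg hT' ht.1, fpow_one, Real.rpow_one] at hfs
  simp only [Function.comp_apply]
  set r := rho T t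
  set p := |r - s| ^ α
  set q := fpow α (r - s)
  have hq : |G * q| ≤ |G| * p := by
    rw [abs_mul]
    exact mul_le_mul_of_nonneg_left (abs_fpow_le α (r - s)) (abs_nonneg G)
  have hp : 0 ≤ p := Real.rpow_nonneg (abs_nonneg _) α
  have hgp : |g r - g s| ≤ (|G| + η) * p := by
    calc |g r - g s| = |(g r - g s - G * q) + G * q| := by ring_nf
      _ ≤ |g r - g s - G * q| + |G * q| := abs_add_le _ _
      _ ≤ (|G| + η) * p := by linarith
  calc |f (g r) - f (g s) - D * G * q|
      = |(f (g r) - f (g s) - D * (g r - g s)) + D * (g r - g s - G * q)| := by ring_nf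
    _ ≤ |f (g r) - f (g s) - D * (g r - g s)| + |D| * |g r - g s - G * q| :=
        (abs_add_le _ _).trans_eq (by rw [abs_mul])
    _ ≤ θ * ((|G| + η) * p) + |D| * (η * p) :=
        add_le_add (hfs.trans (mul_le_mul_of_nonneg_left hgp hθ0.le))
          (mul_le_mul_of_nonneg_left hgs (abs_nonneg D))
    _ = (θ * (|G| + η) + |D| * η) * p := by ring
    _ ≤ ε * p := mul_le_mul_of_nonneg_right (by linarith) hp
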